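/- Let 0 < β < 1 and define the standard fractional Poisson probabilities P_β(n,t) = (1/n!) t^{nβ} ∫_0^∞ z^n e^{-z t^β} M_β(z) dz. Fix z₀ > 0. Then along any sequence of pairs (n, t) with n a positive integer, t > 0, n t^{-β} = z₀, and t → ∞, one has t^{β} · P_β(n,t) → M_β(z₀). -/

import Mathlib

open MeasureTheory Filter Real

/-- The M-Wright (Mainardi) function
`M_β(z) = (1/π) ∑_{j=1}^∞ (−z)^{j−1}/(j−1)! · Γ(βj) · sin(πβj)`. -/
noncomputable def mWright (β z : ℝ) : ℝ :=
  (1 / π) * ∑' j : ℕ, (-z) ^ j / (Nat.factorial j : ℝ) *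
    Real.Gamma (β * (j + 1)) * Real.sin (π * β * (j + 1))

theorem integral_rpow_mul_cexp_neg_mul_Ioi {w : ℝ} (hw : 0 < w) {r : ℂ} (hr : 0 < r.re) :
    ∫ s in Set.Ioi (0 : ℝ), ((s ^ (w - 1) : ℝ) : ℂ) * Complex.exp (-(r * s)) =
      (1 / r) ^ (w : ℂ) * (Real.Gamma w : ℂ) := by
  set μ : Measure ℝ := (volume.restrict (Set.Ioi 0)).withDensity
    (fun s => ENNReal.ofReal (s ^ (w - 1))) with hμ
  have hmeas : Measurable (fun s : ℝ => ENNReal.ofReal (s ^ (w - 1))) := by fun_prop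
  have htop : ∀ᵐ s ∂(volume.restrict (Set.Ioi (0 : ℝ))),
      ENNReal.ofReal (s ^ (w - 1)) < ⊤ := by simp
  have hmgf : ∀ z : ℂ, ProbabilityTheory.complexMGF id μ (-z) =
      ∫ s in Set.Ioi (0 : ℝ), ((s ^ (w - 1) : ℝ) : ℂ) * Complex.exp (-(z * s)) := by
    intro z
    rw [ProbabilityTheory.complexMGF, hμ,
      integral_withDensity_eq_integral_toReal_smul hmeas htop]
    refine setIntegral_congr_fun measurableSet_Ioi fun s hs => ?_
    have : 0 ≤ s ^ (w - 1) := rpow_nonneg (le_of_lt hs) _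
    simp [ENNReal.toReal_ofReal this]
  have hset : Set.Iio 0 ⊆ ProbabilityTheory.integrableExpSet id μ := by
    intro x hx
    have hx' : x < 0 := hx
    rw [ProbabilityTheory.integrableExpSet, Set.mem_ofPred_eq, hμ,
      integrable_withDensity_iff hmeas htop]
    have h := integrableOn_rpow_mul_exp_neg_mul_rpow (s := w - 1) (by linarith) one_pos
      (neg_pos.2 hx')
    refine h.congr_fun (fun s hs => ?_) measurableSet_Ioi
    have : 0 ≤ s ^ (w - 1) := rpow_nonneg (le_of_lt hs) _
    simp [ENNReal.toReal_ofReal this, mul_comm]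
  have hint : Set.Iio 0 ⊆ interior (ProbabilityTheory.integrableExpSet id μ) :=
    interior_maximal hset isOpen_Iio
  set U : Set ℂ := {z | 0 < z.re}
  have hUo : IsOpen U := isOpen_lt continuous_const Complex.continuous_re
  have hU : IsPreconnected U := (convex_halfSpace_re_gt 0).isPreconnected
  have hf : AnalyticOnNhd ℂ (fun z => ProbabilityTheory.complexMGF id μ (-z)) U := by
    intro z hz
    refine AnalyticAt.fun_comp (ProbabilityTheory.analyticAt_complexMGF (hint ?_)) ?_
    · simpa [U] using hz
    · fun_prop
  have hg : AnalyticOnNhd ℂ (fun z : ℂ => (1 / z) ^ (w : ℂ) * (Real.Gamma w : ℂ)) U := by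
    refine DifferentiableOn.analyticOnNhd (fun z hz => ?_) hUo
    have hz : 0 < z.re := hz
    have hz0 : z ≠ 0 := by rintro rfl; simp at hz
    refine DifferentiableAt.differentiableWithinAt ?_
    refine DifferentiableAt.mul_const (DifferentiableAt.cpow_const ?_ ?_) _
    · exact (differentiableAt_const _).div differentiableAt_id hz0
    · left
      rw [one_div, Complex.inv_re]
      exact div_pos hz (Complex.normSq_pos.2 hz0)
  have hfreq : ∃ᶠ z in nhdsWithin (1 : ℂ) {1}ᶜ, ProbabilityTheory.complexMGF id μ (-z) =
      (1 / z) ^ (w : ℂ) * (Real.Gamma w : ℂ) := by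
    have hlim : Tendsto (fun n : ℕ => ((1 + 1 / ((n : ℝ) + 1) : ℝ) : ℂ)) atTop
        (nhdsWithin (1 : ℂ) {1}ᶜ) := by
      refine tendsto_nhdsWithin_iff.2 ⟨?_, Eventually.of_forall fun n => ?_⟩
      · have h := (tendsto_one_div_add_atTop_nhds_zero_nat (𝕜 := ℝ)).const_add 1
        have h2 := (Complex.continuous_ofReal.tendsto _).comp h
        simpa [Function.comp_def] using h2
      · have : (0 : ℝ) < 1 / ((n : ℝ) + 1) := by positivity
        rw [Set.mem_compl_singleton_iff, Ne, Complex.ofReal_eq_one]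
        linarith
    refine hlim.frequently (Eventually.frequently (Eventually.of_forall fun n => ?_))
    have hp : (0 : ℝ) < 1 + 1 / ((n : ℝ) + 1) := by positivity
    generalize (1 + 1 / ((n : ℝ) + 1) : ℝ) = x at hp
    rw [hmgf, ← Complex.Gamma_ofReal,
      ← Complex.integral_cpow_mul_exp_neg_mul_Ioi (by simpa using hw) hp]
    refine setIntegral_congr_fun measurableSet_Ioi fun s hs => ?_
    rw [Complex.ofReal_cpow (le_of_lt hs)]
    push_cast
    rfl
  rw [← hmgf]
  exact hf.eqOn_of_preconnected_of_frequently_eq hg hU (by simp [U]) hfreq hr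

/-- The integrand of a Hankel-type integral representation of `mWright β z`, along the ray of
argument `θ`. -/
noncomputable def mWrightKernel (β θ z s : ℝ) : ℂ :=
  ((s ^ (β - 1) : ℝ) : ℂ) * Complex.exp (s * Complex.exp (θ * Complex.I)) *
    Complex.exp (θ * β * Complex.I) *
    Complex.exp (-(z * s ^ β : ℝ) * Complex.exp (θ * β * Complex.I))

theorem integrableOn_rpow_mul_exp_mul_exp_rpow {β a : ℝ} (hβ0 : 0 < β) (hβ1 : β < 1) (ha : 0 < a)
    {b : ℝ} (hb : 0 ≤ b) :
    IntegrableOn (fun s : ℝ => s ^ (β - 1) * Real.exp (-a * s) * Real.exp (b * s ^ β))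
      (Set.Ioi 0) := by
  obtain ⟨d, hd, hdc⟩ : ∃ d : ℝ, 0 < d ∧ b * d ^ (β - 1) ≤ a / 2 := by
    refine ⟨(a / (2 * (b + 1))) ^ (β - 1)⁻¹, by positivity, ?_⟩
    rw [rpow_inv_rpow (by positivity) (by linarith), mul_div_assoc', div_le_div_iff₀ (by positivity)
      two_pos]
    nlinarith
  have hle : ∀ s : ℝ, 0 < s → b * s ^ β ≤ b * d ^ β + a / 2 * s := by
    intro s hs
    have h1 : (s / d) ^ β ≤ 1 + s / d := by
      have hsd : 0 < s / d := by positivity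
      rcases le_total (s / d) 1 with h | h
      · linarith [rpow_le_one hsd.le h hβ0.le]
      · linarith [rpow_le_self_of_one_le h hβ1.le]
    have h2 : s ^ β ≤ d ^ β + d ^ (β - 1) * s := by
      rw [div_rpow hs.le hd.le, div_le_iff₀ (by positivity)] at h1
      rw [rpow_sub_one hd.ne']
      calc _ ≤ _ := h1
        _ = _ := by field_simp
    nlinarith [mul_le_mul_of_nonneg_left h2 hb, mul_le_mul_of_nonneg_right hdc hs.le]
  have hdom := (integrableOn_rpow_mul_exp_neg_mul_rpow (s := β - 1) (by linarith) one_pos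
    (half_pos ha)).const_mul (Real.exp (b * d ^ β))
  refine Integrable.mono' hdom (by fun_prop) ?_
  refine (ae_restrict_iff' measurableSet_Ioi).2 (Eventually.of_forall fun s hs => ?_)
  have hs : 0 < s := hs
  rw [Real.norm_of_nonneg (by positivity), mul_assoc, ← Real.exp_add, mul_left_comm,
    ← Real.exp_add, rpow_one]
  refine mul_le_mul_of_nonneg_left (Real.exp_le_exp.2 ?_) (by positivity)
  linarith [hle s hs]

theorem norm_cexp_mul_cexp_mul_I (s θ : ℝ) :
    ‖Complex.exp (s * Complex.exp (θ * Complex.I))‖ = Real.exp (Real.cos θ * s) := by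
  rw [Complex.norm_exp]
  congr 1
  rw [Complex.re_ofReal_mul, Complex.exp_ofReal_mul_I_re, mul_comm]

theorem mWright_term_eq_im_integral {β θ : ℝ} (hβ0 : 0 < β) (hθ : π / 2 < θ) (hθπ : θ < π)
    (z : ℝ) (j : ℕ) :
    (-z) ^ j / (Nat.factorial j : ℝ) * Real.Gamma (β * (j + 1)) * Real.sin (π * β * (j + 1)) =
      (∫ s in Set.Ioi (0 : ℝ), ((s ^ (β * (j + 1) - 1) : ℝ) : ℂ) *
        Complex.exp (s * Complex.exp (θ * Complex.I)) *
        (Complex.exp (θ * β * Complex.I) ^ (j + 1) *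
          ((-z) ^ j / (Nat.factorial j : ℝ) : ℝ))).im := by
  set w : ℝ := β * (j + 1) with hw
  have hw0 : 0 < w := by positivity
  have hr : 0 < (-Complex.exp (θ * Complex.I)).re := by
    rw [Complex.neg_re, Complex.exp_ofReal_mul_I_re]
    linarith [cos_neg_of_pi_div_two_lt_of_lt hθ (by linarith)]
  have hinv : 1 / -Complex.exp (θ * Complex.I) = Complex.exp ((π - θ) * Complex.I) := by
    rw [sub_mul, Complex.exp_sub, Complex.exp_pi_mul_I]
    field_simp
  have hpow : (1 / -Complex.exp (θ * Complex.I)) ^ (w : ℂ) =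
      Complex.exp ((π - θ) * Complex.I * w) := by
    rw [hinv, Complex.cpow_def_of_ne_zero (Complex.exp_ne_zero _), Complex.log_exp]
    · simpa using by linarith
    · simpa using by linarith
  have hint := integral_rpow_mul_cexp_neg_mul_Ioi hw0 hr
  rw [integral_mul_const]
  simp only [neg_mul, neg_neg] at hint
  simp_rw [mul_comm (Complex.exp (θ * Complex.I)) _] at hint
  rw [hint, hpow, ← Complex.exp_nat_mul]
  have hexp : Complex.exp ((π - θ) * Complex.I * w) *
      Complex.exp ((j + 1 : ℕ) * (θ * β * Complex.I)) = Complex.exp ((π * w : ℝ) * Complex.I) := by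
    rw [← Complex.exp_add, hw]
    congr 1
    push_cast
    ring
  have : Complex.exp ((π - θ) * Complex.I * w) * (Real.Gamma w : ℂ) *
      (Complex.exp ((j + 1 : ℕ) * (θ * β * Complex.I)) * ((-z) ^ j / (Nat.factorial j : ℝ) : ℝ)) =
      ((Real.Gamma w * ((-z) ^ j / (Nat.factorial j : ℝ)) : ℝ) : ℂ) *
        Complex.exp ((π * w : ℝ) * Complex.I) := by
    rw [← hexp]
    push_cast
    ring
  rw [this, Complex.im_ofReal_mul, Complex.exp_ofReal_mul_I_im, hw, ← mul_assoc π]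
  ring

theorem mWright_eq_im_integral {β θ : ℝ} (hβ0 : 0 < β) (hβ1 : β < 1) (hθ : π / 2 < θ)
    (hθπ : θ < π) (z : ℝ) :
    mWright β z = 1 / π * (∫ s in Set.Ioi (0 : ℝ), mWrightKernel β θ z s).im := by
  have hc : 0 < -Real.cos θ := by
    linarith [cos_neg_of_pi_div_two_lt_of_lt hθ (by linarith)]
  have hunit : ‖Complex.exp (θ * β * Complex.I)‖ = 1 := by
    rw [← Complex.ofReal_mul, Complex.norm_exp_ofReal_mul_I]
  have hpow : ∀ (s : ℝ) (j : ℕ), 0 < s → s ^ (β * (j + 1) - 1) = s ^ (β - 1) * (s ^ β) ^ j := by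
    intro s j hs
    rw [← rpow_natCast, ← rpow_mul hs.le, ← rpow_add hs]
    ring_nf
  have hbound : ∀ s : ℝ, HasSum (fun j : ℕ => s ^ (β - 1) * Real.exp (-(-Real.cos θ) * s) *
      ((|z| * s ^ β) ^ j / (Nat.factorial j : ℝ)))
      (s ^ (β - 1) * Real.exp (-(-Real.cos θ) * s) * Real.exp (|z| * s ^ β)) := by
    intro s
    rw [Real.exp_eq_exp_ℝ]
    exact (NormedSpace.expSeries_div_hasSum_exp (|z| * s ^ β)).mul_left _
  have key := hasSum_integral_of_dominated_convergence (μ := volume.restrict (Set.Ioi (0 : ℝ)))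
    (F := fun (j : ℕ) (s : ℝ) => ((s ^ (β * (j + 1) - 1) : ℝ) : ℂ) *
        Complex.exp (s * Complex.exp (θ * Complex.I)) *
        (Complex.exp (θ * β * Complex.I) ^ (j + 1) * ((-z) ^ j / (Nat.factorial j : ℝ) : ℝ)))
    (f := mWrightKernel β θ z)
    (fun j s => s ^ (β - 1) * Real.exp (-(-Real.cos θ) * s) *
      ((|z| * s ^ β) ^ j / (Nat.factorial j : ℝ)))
    (fun j => by fun_prop) ?_ (Eventually.of_forall fun s => (hbound s).summable) ?_ ?_
  · rw [mWright]
    congr 1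
    simp_rw [mWright_term_eq_im_integral hβ0 hθ hθπ]
    exact (Complex.hasSum_im key).tsum_eq
  · intro j
    refine (ae_restrict_iff' measurableSet_Ioi).2 (Eventually.of_forall fun s hs => le_of_eq ?_)
    have hs : 0 < s := hs
    rw [norm_mul, norm_mul, norm_mul, norm_pow, hunit, norm_cexp_mul_cexp_mul_I, hpow s j hs,
      Complex.norm_real, Complex.norm_real, Real.norm_of_nonneg (by positivity), norm_div, norm_pow,
      norm_neg, Real.norm_natCast, Real.norm_eq_abs, neg_neg]
    ring
  · simp_rw [fun s => (hbound s).tsum_eq]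
    exact integrableOn_rpow_mul_exp_mul_exp_rpow hβ0 hβ1 hc (abs_nonneg z)
  · refine (ae_restrict_iff' measurableSet_Ioi).2 (Eventually.of_forall fun s hs => ?_)
    have h := (NormedSpace.expSeries_div_hasSum_exp
      (-(z * s ^ β : ℝ) * Complex.exp (θ * β * Complex.I))).mul_left
      (((s ^ (β - 1) : ℝ) : ℂ) * Complex.exp (s * Complex.exp (θ * Complex.I)) *
        Complex.exp (θ * β * Complex.I))
    rw [← Complex.exp_eq_exp_ℂ] at h
    refine h.congr_fun fun j => ?_
    rw [hpow s j hs]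
    push_cast
    ring

theorem norm_mWrightKernel_le {β θ : ℝ} (hθ0 : 0 ≤ θ * β) (hθβ : θ * β ≤ π / 2) {z s : ℝ}
    (hz : 0 ≤ z) (hs : 0 < s) :
    ‖mWrightKernel β θ z s‖ ≤ s ^ (β - 1) * Real.exp (Real.cos θ * s) := by
  have hcos : 0 ≤ Real.cos (θ * β) := cos_nonneg_of_mem_Icc ⟨by linarith [pi_pos], hθβ⟩
  have h := norm_cexp_mul_cexp_mul_I (-(z * s ^ β)) (θ * β)
  push_cast at h
  rw [mWrightKernel, norm_mul, norm_mul, norm_mul, norm_cexp_mul_cexp_mul_I,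
    ← Complex.ofReal_mul θ, Complex.norm_exp_ofReal_mul_I, Complex.norm_real,
    Real.norm_of_nonneg (by positivity), mul_one]
  push_cast
  rw [h]
  refine mul_le_of_le_one_right (by positivity) (Real.exp_le_one_iff.2 ?_)
  have : 0 ≤ z * s ^ β := by positivity
  nlinarith [mul_nonneg hcos this]

theorem mWright_bounded_and_continuousOn {β : ℝ} (hβ0 : 0 < β) (hβ1 : β < 1) :
    (∃ C, ∀ z, 0 < z → |mWright β z| ≤ C) ∧ ContinuousOn (mWright β) (Set.Ioi 0) := by
  obtain ⟨θ, hθ, hθ'⟩ : ∃ θ, π / 2 < θ ∧ θ < min π (π / 2 / β) := by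
    refine exists_between (lt_min (by linarith [pi_pos]) ?_)
    rw [lt_div_iff₀ hβ0]
    nlinarith [pi_pos]
  obtain ⟨hθπ, hθβ⟩ := lt_min_iff.1 hθ'
  rw [lt_div_iff₀ hβ0] at hθβ
  have hc : Real.cos θ < 0 := cos_neg_of_pi_div_two_lt_of_lt hθ (by linarith)
  have hθ0 : 0 ≤ θ * β := mul_nonneg (by linarith [pi_pos]) hβ0.le
  have hint : IntegrableOn (fun s : ℝ => s ^ (β - 1) * Real.exp (Real.cos θ * s)) (Set.Ioi 0) := by
    simpa using integrableOn_rpow_mul_exp_neg_mul_rpow (s := β - 1) (by linarith) one_pos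
      (neg_pos.2 hc)
  have hbound : ∀ z ∈ Set.Ioi (0 : ℝ), ∀ᵐ s ∂volume.restrict (Set.Ioi (0 : ℝ)),
      ‖mWrightKernel β θ z s‖ ≤ s ^ (β - 1) * Real.exp (Real.cos θ * s) := fun z hz =>
    (ae_restrict_iff' measurableSet_Ioi).2 (Eventually.of_forall fun s hs =>
      norm_mWrightKernel_le hθ0 hθβ.le (le_of_lt hz) hs)
  refine ⟨⟨1 / π * ∫ s in Set.Ioi (0 : ℝ), s ^ (β - 1) * Real.exp (Real.cos θ * s),
    fun z hz => ?_⟩, ?_⟩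
  · rw [mWright_eq_im_integral hβ0 hβ1 hθ hθπ, abs_mul, abs_of_pos (by positivity)]
    refine mul_le_mul_of_nonneg_left ?_ (by positivity)
    exact (Complex.abs_im_le_norm _).trans (norm_integral_le_of_norm_le hint (hbound z hz))
  · have hK : ContinuousOn (fun z => ∫ s in Set.Ioi (0 : ℝ), mWrightKernel β θ z s)
        (Set.Ioi 0) := by
      refine continuousOn_of_dominated (fun z _ => ?_) hbound hint
        (Eventually.of_forall fun s => ?_)
      · unfold mWrightKernel
        fun_prop
      · unfold mWrightKernel
        fun_prop
    refine (continuousOn_const.mul (Complex.continuous_im.comp_continuousOn hK)).congr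
      fun z _ => mWright_eq_im_integral hβ0 hβ1 hθ hθπ z

theorem integrableOn_pow_mul_exp_neg_mul (m : ℕ) {x : ℝ} (hx : 0 < x) :
    IntegrableOn (fun z : ℝ => z ^ m * Real.exp (-(z * x))) (Set.Ioi 0) := by
  have h := integrableOn_rpow_mul_exp_neg_mul_rpow (s := (m : ℝ)) (by
    linarith [Nat.cast_nonneg (α := ℝ) m]) one_pos hx
  simpa [mul_comm x] using h

theorem integral_pow_mul_exp_neg_mul (m : ℕ) {x : ℝ} (hx : 0 < x) :
    ∫ z in Set.Ioi (0 : ℝ), z ^ m * Real.exp (-(z * x)) = (Nat.factorial m : ℝ) / x ^ (m + 1) := by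
  have h := Real.integral_rpow_mul_exp_neg_mul_Ioi (a := (m : ℝ) + 1) (by positivity) hx
  rw [Real.Gamma_nat_eq_factorial] at h
  simp only [add_sub_cancel_right, rpow_natCast, mul_comm x] at h
  rw [h, ← Nat.cast_add_one, rpow_natCast, one_div, inv_pow]
  ring

theorem integral_gamma_density_mul_add_sq {n : ℕ} {x z₀ : ℝ} (hx : 0 < x) (hn : (n : ℝ) = z₀ * x)
    (a b : ℝ) :
    IntegrableOn (fun z : ℝ => z ^ n * Real.exp (-(z * x)) * (a + b * (z - z₀) ^ 2)) (Set.Ioi 0) ∧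
    x ^ (n + 1) / (Nat.factorial n : ℝ) * ∫ z in Set.Ioi (0 : ℝ),
      z ^ n * Real.exp (-(z * x)) * (a + b * (z - z₀) ^ 2) =
        a + b * (z₀ / x + 2 / x ^ 2) := by
  have h0 := (integrableOn_pow_mul_exp_neg_mul n hx).const_mul (a + b * z₀ ^ 2)
  have h1 := (integrableOn_pow_mul_exp_neg_mul (n + 1) hx).const_mul (-2 * b * z₀)
  have h2 := (integrableOn_pow_mul_exp_neg_mul (n + 2) hx).const_mul b
  have heq : (fun z : ℝ => z ^ n * Real.exp (-(z * x)) * (a + b * (z - z₀) ^ 2)) =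
      fun z => (a + b * z₀ ^ 2) * (z ^ n * Real.exp (-(z * x))) +
        -2 * b * z₀ * (z ^ (n + 1) * Real.exp (-(z * x))) +
        b * (z ^ (n + 2) * Real.exp (-(z * x))) := by
    funext z
    ring
  rw [heq]
  refine ⟨(h0.add h1).add h2, ?_⟩
  rw [integral_add (by exact h0.add h1) h2, integral_add h0 h1]
  simp only [integral_const_mul, integral_pow_mul_exp_neg_mul _ hx]
  have hz : z₀ = n / x := by rw [hn]; field_simp
  have hf : (Nat.factorial n : ℝ) ≠ 0 := by positivity
  rw [hz, Nat.factorial_succ (n + 1), Nat.factorial_succ n]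
  push_cast
  field_simp
  ring

theorem tendsto_integral_gamma_density {f : ℝ → ℝ} {C : ℝ} (hC : ∀ z, 0 < z → |f z| ≤ C)
    (hf : ContinuousOn f (Set.Ioi 0)) {z₀ : ℝ} (hz₀ : 0 < z₀) {ι : Type*} {l : Filter ι}
    {n : ι → ℕ} {x : ι → ℝ} (hx : Tendsto x l atTop) (hn : ∀ᶠ k in l, (n k : ℝ) = z₀ * x k) :
    Tendsto (fun k => x k ^ (n k + 1) / (Nat.factorial (n k) : ℝ) *
      ∫ z in Set.Ioi (0 : ℝ), z ^ n k * Real.exp (-(z * x k)) * f z) l (nhds (f z₀)) := by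
  rw [Metric.tendsto_nhds]
  intro ε hε
  obtain ⟨δ, hδ, hδf⟩ := Metric.continuousAt_iff.1 (hf.continuousAt (Ioi_mem_nhds hz₀)) (ε / 2)
    (half_pos hε)
  set K := 2 * C / δ ^ 2
  have hpt : ∀ z, 0 < z → |f z - f z₀| ≤ ε / 2 + K * (z - z₀) ^ 2 := by
    intro z hz
    have hC0 : 0 ≤ C := (abs_nonneg _).trans (hC z hz)
    have hK0 : 0 ≤ K := by positivity
    by_cases h : |z - z₀| < δ
    · have := hδf (x := z) (by rwa [Real.dist_eq])
      rw [Real.dist_eq] at this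
      nlinarith [mul_nonneg hK0 (sq_nonneg (z - z₀))]
    · have h1 : δ ^ 2 ≤ (z - z₀) ^ 2 := by
        rw [← sq_abs (z - z₀)]
        exact pow_le_pow_left₀ hδ.le (not_lt.1 h) 2
      have h2 : 2 * C = K * δ ^ 2 := by simp only [K]; field_simp
      have h3 := abs_sub (f z) (f z₀)
      nlinarith [hC z hz, hC z₀ hz₀, mul_le_mul_of_nonneg_left h1 hK0]
  have hlim : Tendsto (fun k => ε / 2 + K * (z₀ / x k + 2 / x k ^ 2)) l (nhds (ε / 2)) := by
    have h1 : Tendsto (fun k => z₀ / x k) l (nhds 0) := hx.const_div_atTop z₀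
    have h2 : Tendsto (fun k => 2 / x k ^ 2) l (nhds 0) :=
      ((tendsto_pow_atTop two_ne_zero).comp hx).const_div_atTop 2
    simpa using ((h1.add h2).const_mul K).const_add (ε / 2)
  filter_upwards [hn, hx.eventually_gt_atTop 0, hlim.eventually_lt_const (half_lt_self hε)]
    with k hnk hxk hk
  obtain ⟨hi, he⟩ := integral_gamma_density_mul_add_sq hxk hnk (ε / 2) K
  obtain ⟨hi1, he1⟩ := integral_gamma_density_mul_add_sq hxk hnk (f z₀) 0
  simp only [zero_mul, add_zero] at hi1 he1
  have hmeas : AEStronglyMeasurable f (volume.restrict (Set.Ioi 0)) :=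
    hf.aestronglyMeasurable measurableSet_Ioi
  have hi2 : IntegrableOn (fun z => z ^ n k * Real.exp (-(z * x k)) * f z) (Set.Ioi 0) := by
    refine (integrableOn_pow_mul_exp_neg_mul (n k) hxk).mul_bdd hmeas (c := C) ?_
    exact (ae_restrict_iff' measurableSet_Ioi).2 (Eventually.of_forall hC)
  refine lt_of_le_of_lt ?_ hk
  rw [← he, Real.dist_eq]
  nth_rewrite 1 [← he1]
  rw [← mul_sub, ← integral_sub hi2 hi1, abs_mul, abs_of_pos (by positivity)]
  refine mul_le_mul_of_nonneg_left ?_ (by positivity)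
  rw [← Real.norm_eq_abs]
  refine norm_integral_le_of_norm_le hi ?_
  refine (ae_restrict_iff' measurableSet_Ioi).2 (Eventually.of_forall fun z hz => ?_)
  have hz : 0 < z := hz
  rw [← mul_sub, norm_mul, Real.norm_of_nonneg (by positivity), Real.norm_eq_abs]
  exact mul_le_mul_of_nonneg_left (hpt z hz) (by positivity)

/-- Dynamical scaling for the standard fractional Poisson process. -/
theorem fPp_dynamical_scaling
    (β : ℝ) (hβ0 : 0 < β) (hβ1 : β < 1)
    (P : ℕ → ℝ → ℝ)
    (hP : ∀ (n : ℕ) (t : ℝ), 0 < t →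
      P n t = (1 / (Nat.factorial n : ℝ)) * t ^ ((n : ℝ) * β) *
        ∫ z in Set.Ioi (0 : ℝ), z ^ n * Real.exp (-(z * t ^ β)) * mWright β z)
    (z₀ : ℝ) (hz₀ : 0 < z₀)
    (n : ℕ → ℕ) (t : ℕ → ℝ)
    (hn : ∀ k, 0 < n k) (ht : ∀ k, 0 < t k)
    (hrel : ∀ k, (n k : ℝ) * (t k) ^ (-β) = z₀)
    (htinf : Tendsto t atTop atTop) :
    Tendsto (fun k => (t k) ^ β * P (n k) (t k)) atTop (nhds (mWright β z₀)) := by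
  obtain ⟨⟨C, hC⟩, hcont⟩ := mWright_bounded_and_continuousOn hβ0 hβ1
  have hx : Tendsto (fun k => t k ^ β) atTop atTop := (tendsto_rpow_atTop hβ0).comp htinf
  have hnx : ∀ k, (n k : ℝ) = z₀ * t k ^ β := by
    intro k
    rw [← hrel k, mul_assoc, ← rpow_add (ht k), neg_add_cancel, rpow_zero, mul_one]
  refine (tendsto_integral_gamma_density hC hcont hz₀ hx (Eventually.of_forall hnx)).congr
    fun k => ?_
  rw [hP _ _ (ht k), mul_comm (n k : ℝ) β, rpow_mul (ht k).le, rpow_natCast]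
  ring
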